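/- Quantitative stability for thinly supported measures on the torus (Theorem 1.3, case M = 𝕋^d): Let d ≥ 1, let k be a real number with 0 < k < d, let p be real with 2 < p < 2d/k, and fix C_E > 0 and δ₀ ∈ (0,1]. Then there exist an even Schwartz function ψ : ℝ → ℂ whose Fourier transform ψ̂ is supported in [−1,1] and with ψ(0) = 1, and a constant C > 0 (depending only on d, k, p, ψ, C_E, δ₀), such that: for every compact set E ⊆ 𝕋^d satisfying volume(E^δ) ≤ C_E · δ^{d−k} for all 0 < δ ≤ δ₀, every finite complex Borel measure μ supported in E with Σ_n a_n(μ)^p < ∞, every R ≥ 1, and every continuous χ : 𝕋^d → ℂ, the absolutely convergent sum P_Rμ(x) := Σ_{j} ψ(|j|/R) μ̂(j) e_j(x) defines a continuous function satisfying |∫_{𝕋^d} P_Rμ(x) · conj(χ(x)) dvolume(x)| ≤ C · (Σ_n a_n(μ)^p)^{1/p} · (sup_x |χ(x)|) · R^{k/2 − d/p}. -/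

import Mathlib

open MeasureTheory Complex Filter FourierTransform Metric
open scoped Real

noncomputable section

abbrev Torus (d : ℕ) := Fin d → AddCircle (1 : ℝ)

/-- The character `e_j(x) = ∏ m, exp(2πi j_m x_m)` on the torus. -/
def torusChar {d : ℕ} (j : Fin d → ℤ) (x : Torus d) : ℂ :=
  ∏ m, fourier (j m) (x m)

/-- `|j| = (Σ_m j_m²)^{1/2}` for a frequency `j : Fin d → ℤ`. -/
def jnorm {d : ℕ} (j : Fin d → ℤ) : ℝ :=
  Real.sqrt (∑ m, ((j m : ℝ)) ^ 2)

/-- Integration of a complex-valued function against a finite complex measure,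
via the Jordan decompositions of the real and imaginary parts. -/
def cIntegral {X : Type*} [MeasurableSpace X] (μ : ComplexMeasure X) (f : X → ℂ) : ℂ :=
  ((∫ x, f x ∂((ComplexMeasure.re μ).toJordanDecomposition.posPart))
    - (∫ x, f x ∂((ComplexMeasure.re μ).toJordanDecomposition.negPart)))
  + Complex.I * ((∫ x, f x ∂((ComplexMeasure.im μ).toJordanDecomposition.posPart))
    - (∫ x, f x ∂((ComplexMeasure.im μ).toJordanDecomposition.negPart)))

/-- The Fourier coefficient `μ̂(j) = ∫ conj (e_j) dμ` of a finite complex measure. -/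
def muHat {d : ℕ} (μ : ComplexMeasure (Torus d)) (j : Fin d → ℤ) : ℂ :=
  cIntegral μ (fun x => starRingEnd ℂ (torusChar j x))

/-- `a_n(μ) = ‖E_{√n} μ‖ = (Σ_{|j|² = n} |μ̂(j)|²)^{1/2}`, the `L²` norm of the spectral
projection of `μ` onto the Laplace eigenspace with eigenvalue `-n`. -/
def aCoeff {d : ℕ} (μ : ComplexMeasure (Torus d)) (n : ℕ) : ℝ :=
  Real.sqrt (∑' j : {j : Fin d → ℤ // (∑ m, (j m) ^ 2) = (n : ℤ)}, ‖muHat μ (j : Fin d → ℤ)‖ ^ 2)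

/-- The topological support of a complex measure: the set of points all of whose
neighborhoods contain a measurable set of nonzero measure. -/
def msupport {X : Type*} [TopologicalSpace X] [MeasurableSpace X] (μ : ComplexMeasure X) : Set X :=
  {x | ∀ U : Set X, IsOpen U → x ∈ U → ∃ A : Set X, MeasurableSet A ∧ A ⊆ U ∧ μ A ≠ 0}

/-- the normalized measure -/
def nuT (d : ℕ) : Measure (Torus d) := Measure.pi fun _ => AddCircle.haarAddCircle

lemma nuT_eq (d : ℕ) : nuT d = volume := by
  have : (volume : Measure (AddCircle (1:ℝ))) = AddCircle.haarAddCircle := by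
    rw [AddCircle.volume_eq_smul_haarAddCircle]; simp
  rw [nuT, volume_pi]
  simp [this]

instance : IsProbabilityMeasure (nuT d) := by unfold nuT; infer_instance

instance volT_prob (d : ℕ) : IsProbabilityMeasure (volume : Measure (Torus d)) := by
  rw [← nuT_eq]; infer_instance

lemma torusChar_eq {d : ℕ} (j : Fin d → ℤ) (x : Torus d) :
    torusChar j x = UnitAddTorus.mFourier j x := rfl

lemma torusChar_norm {d : ℕ} (j : Fin d → ℤ) (x : Torus d) : ‖torusChar j x‖ = 1 := by
  simp only [torusChar, norm_prod, fourier_apply, Circle.norm_coe, Finset.prod_const_one]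

lemma torusChar_cont {d : ℕ} (j : Fin d → ℤ) : Continuous (torusChar j) :=
  (UnitAddTorus.mFourier j).continuous

lemma fourier_inv {d : ℕ} (F : C(Torus d, ℂ)) (c : (Fin d → ℤ) → ℂ) (hc : Summable c)
    (h : ∀ j, c j = ∫ x in {x : Fin d → ℝ | ∀ i, x i ∈ Set.Ioc (-(1/2):ℝ) (-(1/2) + 1)},
      torusChar (-j) (fun i => (x i : AddCircle (1:ℝ))) * F (fun i => x i)) (x : Torus d) :
    HasSum (fun j => c j * torusChar j x) (F x) := by
  have e : UnitAddTorus.mFourierCoeff (F : UnitAddTorus (Fin d) → ℂ) = c := by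
    funext j
    rw [h, UnitAddTorus.mFourierCoeff_eq_integral _ _ (fun _ => (-(1/2):ℝ))]
    rfl
  have := UnitAddTorus.hasSum_mFourier_series_apply_of_summable (f := F) (by rw [e]; exact hc) x
  rw [e] at this
  exact this

lemma hasSum_toLp_aux {d : ℕ} {ι : Type*} (ν : Measure (Torus d)) [IsFiniteMeasure ν]
    (c : ι → ℂ) (e : ι → C(Torus d, ℂ)) (G : C(Torus d, ℂ)) (h : HasSum (fun j => c j • e j) G) :
    HasSum (fun j => c j • ContinuousMap.toLp (E := ℂ) 2 ν ℂ (e j))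
      (ContinuousMap.toLp (E := ℂ) 2 ν ℂ G) := by
  have := h.mapL (ContinuousMap.toLp (E := ℂ) 2 ν ℂ)
  simpa only [map_smul] using this

lemma parseval {d : ℕ} (c : (Fin d → ℤ) → ℂ) (hc : Summable c) (hc2 : Summable fun j => ‖c j‖^2) :
    Continuous (fun x : Torus d => ∑' j, c j * torusChar j x) ∧
    ∫ x : Torus d, ‖∑' j, c j * torusChar j x‖^2 = ∑' j, ‖c j‖^2 := by
  have hs : Summable (fun j => c j • UnitAddTorus.mFourier (d := Fin d) j) := by
    apply Summable.of_norm
    simpa [norm_smul, UnitAddTorus.mFourier_norm] using hc.norm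
  set G : C(Torus d, ℂ) := ∑' j, c j • UnitAddTorus.mFourier (d := Fin d) j with hG
  have hGx : ∀ x, G x = ∑' j, c j * torusChar j x := by
    intro x
    have := (ContinuousMap.hasSum_apply hs.hasSum x)
    exact this.tsum_eq.symm
  simp_rw [← hGx]
  refine ⟨G.continuous, ?_⟩
  rw [← nuT_eq]
  have hL := hasSum_toLp_aux (nuT d) c _ G hs.hasSum
  let c2 : lp (fun _ : Fin d → ℤ => ℂ) 2 := ⟨c, by
    apply memℓp_gen; simpa using hc2⟩
  have h2 := UnitAddTorus.mFourierBasis.hasSum_repr_symm c2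
  have h3 : UnitAddTorus.mFourierBasis.repr.symm c2 = ContinuousMap.toLp (E := ℂ) 2 (nuT d) ℂ G := by
    rw [UnitAddTorus.coe_mFourierBasis] at h2
    exact h2.unique hL
  have h4 := congrArg (fun v => ‖v‖^2) h3
  simp only [LinearIsometryEquiv.norm_map] at h4
  have h5 : ‖c2‖^2 = ∑' j, ‖c j‖^2 := by
    have := lp.norm_rpow_eq_tsum (p := 2) (by simp) c2
    simpa using! this
  rw [← h5, h4]
  have h6 := @inner_self_eq_norm_sq ℂ _ _ _ _ (ContinuousMap.toLp (E := ℂ) 2 (nuT d) ℂ G)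
  erw [← h6]
  rw [ContinuousMap.inner_toLp]
  have : ∀ x, G x * (starRingEnd ℂ) (G x) = ((‖G x‖^2 : ℝ) : ℂ) := by
    intro x; rw [Complex.mul_conj']; simp
  simp_rw [this]
  have h7 : ∫ x, ((‖G x‖^2 : ℝ) : ℂ) ∂(nuT d) = ((∫ x, ‖G x‖^2 ∂(nuT d) : ℝ) : ℂ) :=
    integral_ofReal
  rw [h7]
  exact (Complex.ofReal_re _).symm

lemma posPart_null {X : Type*} [MeasurableSpace X] (s : SignedMeasure X)
    (U : Set X) (hU : MeasurableSet U) (h : ∀ A, MeasurableSet A → A ⊆ U → s A = 0) :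
    s.toJordanDecomposition.posPart U = 0 ∧ s.toJordanDecomposition.negPart U = 0 := by
  obtain ⟨P, hP, h1, h2, h3, h4⟩ := s.toJordanDecomposition_spec
  rw [h3, h4]
  constructor
  · rw [SignedMeasure.toMeasureOfZeroLE_apply _ _ hP hU]
    simp [h (P ∩ U) (hP.inter hU) Set.inter_subset_right]
  · rw [SignedMeasure.toMeasureOfLEZero_apply _ _ hP.compl hU]
    simp [h (Pᶜ ∩ U) (hP.compl.inter hU) Set.inter_subset_right]

/-- The four finite measures making up a complex measure. -/
def parts {X : Type*} [MeasurableSpace X] (μ : ComplexMeasure X) : Fin 4 → Measure X :=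
  ![(ComplexMeasure.re μ).toJordanDecomposition.posPart,
    (ComplexMeasure.re μ).toJordanDecomposition.negPart,
    (ComplexMeasure.im μ).toJordanDecomposition.posPart,
    (ComplexMeasure.im μ).toJordanDecomposition.negPart]

instance parts_finite {X : Type*} [MeasurableSpace X] (μ : ComplexMeasure X) (i : Fin 4) :
    IsFiniteMeasure (parts μ i) := by
  fin_cases i <;> simp only [parts] <;> dsimp <;> infer_instance

lemma cIntegral_eq {X : Type*} [MeasurableSpace X] (μ : ComplexMeasure X) (f : X → ℂ) :
    cIntegral μ f = ((∫ x, f x ∂(parts μ 0)) - (∫ x, f x ∂(parts μ 1)))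
      + Complex.I * ((∫ x, f x ∂(parts μ 2)) - (∫ x, f x ∂(parts μ 3))) := rfl

lemma parts_null {d : ℕ} (μ : ComplexMeasure (Torus d)) (E : Set (Torus d))
    (h : msupport μ ⊆ E) (i : Fin 4) : parts μ i Eᶜ = 0 := by
  apply measure_null_of_locally_null
  intro x hx
  have hx' : x ∉ msupport μ := fun h' => hx (h h')
  simp only [msupport, Set.mem_ofPred_eq, not_forall, not_exists, not_and, not_not] at hx'
  obtain ⟨U, hU, hxU, h0⟩ := hx'
  refine ⟨U, mem_nhdsWithin_of_mem_nhds (hU.mem_nhds hxU), ?_⟩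
  have hre := posPart_null (ComplexMeasure.re μ) U hU.measurableSet (fun A hA hAU => by
    have : ComplexMeasure.re μ A = (μ A).re := rfl
    rw [this, h0 A hA hAU]; rfl)
  have him := posPart_null (ComplexMeasure.im μ) U hU.measurableSet (fun A hA hAU => by
    have : ComplexMeasure.im μ A = (μ A).im := rfl
    rw [this, h0 A hA hAU]; rfl)
  fin_cases i
  exacts [hre.1, hre.2, him.1, him.2]

lemma cIntegral_zero {d : ℕ} (μ : ComplexMeasure (Torus d)) (E : Set (Torus d))
    (h : msupport μ ⊆ E) (f : Torus d → ℂ) (hf : ∀ y ∈ E, f y = 0) : cIntegral μ f = 0 := by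
  have : ∀ i, ∫ x, f x ∂(parts μ i) = 0 := by
    intro i
    apply integral_eq_zero_of_ae
    refine measure_mono_null ?_ (parts_null μ E h i)
    intro x hx hxE
    exact hx (hf x hxE)
  rw [cIntegral_eq]
  simp [this]

lemma muHat_bdd {d : ℕ} (μ : ComplexMeasure (Torus d)) : ∃ B : ℝ, 0 ≤ B ∧ ∀ j, ‖muHat μ j‖ ≤ B := by
  have key : ∀ j i, ‖∫ x, starRingEnd ℂ (torusChar j x) ∂(parts μ i)‖ ≤ (parts μ i).real Set.univ := by
    intro j i
    have := norm_integral_le_of_norm_le_const (μ := parts μ i) (C := 1)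
      (f := fun x => starRingEnd ℂ (torusChar j x))
      (Filter.Eventually.of_forall fun x => by simp [torusChar_norm])
    simpa using this
  refine ⟨(parts μ 0).real Set.univ + (parts μ 1).real Set.univ + ((parts μ 2).real Set.univ
    + (parts μ 3).real Set.univ), by positivity, fun j => ?_⟩
  rw [muHat, cIntegral_eq]
  refine (norm_add_le _ _).trans ?_
  rw [norm_mul, Complex.norm_I, one_mul]
  refine add_le_add ((norm_sub_le _ _).trans ?_) ((norm_sub_le _ _).trans ?_)
  · exact add_le_add (key j 0) (key j 1)
  · exact add_le_add (key j 2) (key j 3)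

lemma torusChar_sub {d : ℕ} (j : Fin d → ℤ) (x y : Torus d) :
    torusChar j (x - y) = starRingEnd ℂ (torusChar j y) * torusChar j x := by
  simp only [torusChar, map_prod, ← Finset.prod_mul_distrib]
  refine Finset.prod_congr rfl fun m _ => ?_
  rw [← fourier_neg, Pi.sub_apply, mul_comm]
  simp [fourier_apply, sub_eq_add_neg, smul_add, AddCircle.toCircle_add]

lemma conv_series {d : ℕ} (μ : ComplexMeasure (Torus d)) (F : Torus d → ℂ)
    (c : (Fin d → ℤ) → ℂ) (hc : Summable c)
    (h : ∀ x, HasSum (fun j => c j * torusChar j x) (F x)) (x : Torus d) :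
    ∑' j, c j * muHat μ j * torusChar j x = cIntegral μ (fun y => F (x - y)) := by
  have key : ∀ i, HasSum (fun j => c j * (∫ y, starRingEnd ℂ (torusChar j y) ∂(parts μ i))
      * torusChar j x) (∫ y, F (x - y) ∂(parts μ i)) := by
    intro i
    have := hasSum_integral_of_summable_integral_norm (μ := parts μ i)
      (F := fun j y => c j * torusChar j (x - y)) (fun j => by
        have hcont : Continuous (fun y => c j * torusChar j (x - y)) :=
          continuous_const.mul ((torusChar_cont j).comp (continuous_const.sub continuous_id))
        exact (BoundedContinuousFunction.mkOfCompact ⟨_, hcont⟩).integrable _) (by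
        simp only [norm_mul, torusChar_norm, mul_one, integral_const, smul_eq_mul]
        exact hc.norm.mul_left _)
    simp_rw [fun y => (h (x - y)).tsum_eq] at this
    convert! this using 2 with j
    simp_rw [torusChar_sub]
    rw [integral_const_mul, integral_mul_const, mul_assoc]
  have := ((key 0).sub (key 1)).add (((key 2).sub (key 3)).mul_left Complex.I)
  rw [cIntegral_eq, ← this.tsum_eq]
  congr 1
  funext j
  rw [muHat, cIntegral_eq]
  ring

lemma sum_nat_bd (R : ℝ) (hR : 1 ≤ R) (N : ℕ) :
    ∑ n ∈ Finset.range N, (1 + (((n:ℝ)+1)/R)^2)⁻¹ ≤ 2 * R := by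
  have key : ∑ n ∈ Finset.range N, (1 + (((n:ℝ)+1)/R)^2)⁻¹ ≤ 2 * R - 2 * R^2 / (R + N) := by
    induction N with
    | zero => simp; field_simp; simp
    | succ n ih =>
      rw [Finset.sum_range_succ]
      have hn : (0:ℝ) ≤ n := Nat.cast_nonneg n
      have : (1 + (((n:ℝ)+1)/R)^2)⁻¹ ≤ 2 * R^2 / (R + n) - 2 * R^2 / (R + (n+1)) := by
        have e1 : (1 + (((n:ℝ)+1)/R)^2)⁻¹ = R^2 / (R^2 + (n+1)^2) := by
          field_simp
        have e2 : 2 * R^2 / (R + n) - 2 * R^2 / (R + (n+1)) = 2 * R^2 / ((R+n)*(R+(n+1))) := by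
          field_simp; ring
        rw [e1, e2, div_le_div_iff₀ (by positivity) (by positivity)]
        have : (R+n)*(R+(n+1)) ≤ 2 * (R^2 + (n+1)^2) := by nlinarith [sq_nonneg (R - (n+1))]
        nlinarith [sq_nonneg R]
      push_cast
      linarith
  have : 0 ≤ 2 * R^2 / (R + N) := by positivity
  linarith

lemma sum_int_bd (R : ℝ) (hR : 1 ≤ R) (S : Finset ℤ) :
    ∑ j ∈ S, (1 + ((j:ℝ)/R)^2)⁻¹ ≤ 5 * R := by
  obtain ⟨N, hN⟩ : ∃ N : ℕ, ∀ j ∈ S, j.natAbs ≤ N := by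
    refine ⟨S.sup Int.natAbs, fun j hj => Finset.le_sup (f := Int.natAbs) hj⟩
  have hsub : S ⊆ {0} ∪ ((Finset.range N).image (fun n : ℕ => (n:ℤ)+1) ∪
      (Finset.range N).image (fun n : ℕ => -((n:ℤ)+1))) := by
    intro j hj
    have := hN j hj
    simp only [Finset.mem_union, Finset.mem_singleton, Finset.mem_image, Finset.mem_range]
    rcases lt_trichotomy j 0 with h | h | h
    · right; right; exact ⟨j.natAbs - 1, by omega, by omega⟩
    · left; exact h
    · right; left; exact ⟨j.natAbs - 1, by omega, by omega⟩
  refine (Finset.sum_le_sum_of_subset_of_nonneg hsub (fun _ _ _ => by positivity)).trans ?_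
  have hu : ∀ A B : Finset ℤ, ∑ j ∈ A ∪ B, (1 + ((j:ℝ)/R)^2)⁻¹ ≤
      ∑ j ∈ A, (1 + ((j:ℝ)/R)^2)⁻¹ + ∑ j ∈ B, (1 + ((j:ℝ)/R)^2)⁻¹ := by
    intro A B
    rw [← Finset.sum_union_inter]
    have : 0 ≤ ∑ j ∈ A ∩ B, (1 + ((j:ℝ)/R)^2)⁻¹ := Finset.sum_nonneg fun _ _ => by positivity
    linarith
  have h1 := hu {0} ((Finset.range N).image (fun n : ℕ => (n:ℤ)+1) ∪
      (Finset.range N).image (fun n : ℕ => -((n:ℤ)+1)))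
  have h2 := hu ((Finset.range N).image (fun n : ℕ => (n:ℤ)+1))
      ((Finset.range N).image (fun n : ℕ => -((n:ℤ)+1)))
  have h3 : ∑ j ∈ (Finset.range N).image (fun n : ℕ => (n:ℤ)+1), (1 + ((j:ℝ)/R)^2)⁻¹ ≤ 2 * R := by
    rw [Finset.sum_image (by intro a _ b _ h; simpa using h)]
    simpa using sum_nat_bd R hR N
  have h4 : ∑ j ∈ (Finset.range N).image (fun n : ℕ => -((n:ℤ)+1)), (1 + ((j:ℝ)/R)^2)⁻¹ ≤ 2 * R := by
    rw [Finset.sum_image (by intro a _ b _ h; simpa using h)]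
    refine le_trans (le_of_eq ?_) (sum_nat_bd R hR N)
    refine Finset.sum_congr rfl fun n _ => ?_
    push_cast
    rw [neg_div, neg_sq]
  have h5 : ∑ j ∈ ({0} : Finset ℤ), (1 + ((j:ℝ)/R)^2)⁻¹ = 1 := by simp
  linarith

/-- the weight -/
def wt {d : ℕ} (R : ℝ) (j : Fin d → ℤ) : ℝ := ((1 + (jnorm j / R)^2)^d)⁻¹

lemma wt_nonneg {d : ℕ} (R : ℝ) (j : Fin d → ℤ) : 0 ≤ wt R j := by unfold wt; positivity

lemma wt_le_prod {d : ℕ} (R : ℝ) (j : Fin d → ℤ) :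
    wt R j ≤ ∏ m, (1 + ((j m:ℝ)/R)^2)⁻¹ := by
  rw [wt, Finset.prod_inv_distrib]
  apply inv_anti₀
  · exact Finset.prod_pos fun _ _ => by positivity
  · have : ∏ m : Fin d, (1 + ((j m:ℝ)/R)^2) ≤ ∏ m : Fin d, (1 + (jnorm j / R)^2) := by
      refine Finset.prod_le_prod (fun _ _ => by positivity) fun m _ => ?_
      rw [div_pow, div_pow, jnorm, Real.sq_sqrt (Finset.sum_nonneg fun _ _ => sq_nonneg _)]
      gcongr
      exact Finset.single_le_sum (f := fun m => ((j m:ℝ))^2) (fun _ _ => sq_nonneg _)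
        (Finset.mem_univ m)
    simpa using this

lemma wt_sum_bd {d : ℕ} (R : ℝ) (hR : 1 ≤ R) (S : Finset (Fin d → ℤ)) :
    ∑ j ∈ S, wt R j ≤ (5 * R)^d := by
  classical
  let T : Fin d → Finset ℤ := fun m => S.image (fun j => j m)
  have hS : S ⊆ Fintype.piFinset T := by
    intro j hj
    rw [Fintype.mem_piFinset]
    exact fun m => Finset.mem_image_of_mem _ hj
  calc ∑ j ∈ S, wt R j ≤ ∑ j ∈ S, ∏ m, (1 + ((j m:ℝ)/R)^2)⁻¹ :=
        Finset.sum_le_sum fun j _ => wt_le_prod R j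
    _ ≤ ∑ j ∈ Fintype.piFinset T, ∏ m, (1 + ((j m:ℝ)/R)^2)⁻¹ :=
        Finset.sum_le_sum_of_subset_of_nonneg hS fun _ _ _ =>
          Finset.prod_nonneg fun _ _ => by positivity
    _ = ∏ m, ∑ a ∈ T m, (1 + ((a:ℝ)/R)^2)⁻¹ :=
        (Finset.prod_univ_sum T (fun _ (a:ℤ) => (1 + ((a:ℝ)/R)^2)⁻¹)).symm
    _ ≤ ∏ m : Fin d, (5 * R) := Finset.prod_le_prod
        (fun m _ => Finset.sum_nonneg fun _ _ => by positivity) fun m _ => sum_int_bd R hR _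
    _ = (5 * R)^d := by simp

lemma wt_summable {d : ℕ} (R : ℝ) (hR : 1 ≤ R) : Summable (fun j : Fin d → ℤ => wt R j) :=
  summable_of_sum_le (wt_nonneg R) (wt_sum_bd R hR)

lemma schwartz_decay (d : ℕ) (ψ : SchwartzMap ℝ ℂ) :
    ∃ K : ℝ, 0 < K ∧ ∀ t, ‖ψ t‖ ≤ K * ((1 + t^2)^d)⁻¹ := by
  refine ⟨2^(2*d) * ((Finset.Iic (2*d,0)).sup fun m => SchwartzMap.seminorm ℝ m.1 m.2) ψ + 1,
    by positivity, fun t => ?_⟩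
  have h := SchwartzMap.one_add_le_sup_seminorm_apply (𝕜 := ℝ) (m := (2*d,0)) (k := 2*d) (n := 0)
    le_rfl le_rfl ψ t
  rw [norm_iteratedFDeriv_zero] at h
  rw [← div_eq_mul_inv, le_div_iff₀ (by positivity)]
  have h2 : (1 + t^2)^d ≤ (1 + ‖t‖)^(2*d) := by
    rw [pow_mul]
    gcongr
    rw [Real.norm_eq_abs]
    nlinarith [abs_nonneg t, sq_abs t]
  have := mul_le_mul_of_nonneg_right h2 (norm_nonneg (ψ t))
  dsimp only at h
  linarith

lemma psi_bound {d : ℕ} (ψ : SchwartzMap ℝ ℂ) (s : ℝ) (hs : 1 ≤ s) :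
    ∃ K : ℝ, 0 < K ∧ ∀ R : ℝ, 1 ≤ R →
      Summable (fun j : Fin d → ℤ => ψ (jnorm j / R)) ∧
      Summable (fun j : Fin d → ℤ => ‖ψ (jnorm j / R)‖^s) ∧
      ∑' j : Fin d → ℤ, ‖ψ (jnorm j / R)‖^s ≤ K * R^d := by
  obtain ⟨K, hK, h⟩ := schwartz_decay d ψ
  have hw1 : ∀ R, ∀ j : Fin d → ℤ, wt R j ≤ 1 := fun R j => by
    unfold wt
    apply inv_le_one_of_one_le₀
    apply one_le_pow₀
    have := sq_nonneg (jnorm j / R)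
    linarith
  have hb : ∀ R, ∀ j : Fin d → ℤ, ‖ψ (jnorm j / R)‖^s ≤ K^s * wt R j := by
    intro R j
    have hw := wt_nonneg R j
    calc ‖ψ (jnorm j / R)‖^s ≤ (K * wt R j)^s :=
          Real.rpow_le_rpow (norm_nonneg _) (h _) (by linarith)
      _ = K^s * (wt R j)^s := Real.mul_rpow hK.le hw
      _ ≤ K^s * wt R j := by
          gcongr
          exact Real.rpow_le_self_of_le_one hw (hw1 R j) hs
  refine ⟨K^s * 5^d, by positivity, fun R hR => ?_⟩
  have hsum := (wt_summable (d := d) R hR)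
  have hsum2 : Summable (fun j : Fin d → ℤ => ‖ψ (jnorm j / R)‖^s) :=
    Summable.of_nonneg_of_le (fun _ => by positivity) (hb R) (hsum.mul_left _)
  refine ⟨Summable.of_norm_bounded (hsum.mul_left K) fun j => h _, hsum2, ?_⟩
  refine (hsum2.tsum_le_tsum (hb R) (hsum.mul_left _)).trans ?_
  rw [tsum_mul_left, mul_assoc, ← mul_pow]
  gcongr
  exact hsum.tsum_le_of_sum_le (wt_sum_bd R hR)

lemma fib_finite {d : ℕ} (n : ℕ) : Finite {j : Fin d → ℤ // (∑ m, (j m) ^ 2) = (n : ℤ)} := by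
  have : {j : Fin d → ℤ | (∑ m, (j m) ^ 2) = (n : ℤ)} ⊆
      Set.Icc (fun _ => -(n:ℤ)) (fun _ => (n:ℤ)) := by
    intro j hj
    have hj' : (∑ m, (j m) ^ 2) = (n : ℤ) := hj
    have key : ∀ m, (j m)^2 ≤ n := fun m => by
      rw [← hj']
      exact Finset.single_le_sum (f := fun m => (j m)^2) (fun _ _ => sq_nonneg _) (Finset.mem_univ m)
    constructor
    · intro m; have := key m; show -(n:ℤ) ≤ j m; nlinarith
    · intro m; have := key m; show j m ≤ n; nlinarith
  exact ((Set.finite_Icc _ _).subset this)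

lemma fib_sum_le {d : ℕ} (μ : ComplexMeasure (Torus d)) (n : ℕ) (S : Finset (Fin d → ℤ))
    (hS : ∀ j ∈ S, (∑ m, (j m) ^ 2) = (n : ℤ)) : ∑ j ∈ S, ‖muHat μ j‖^2 ≤ aCoeff μ n ^ 2 := by
  have := fib_finite (d := d) n
  rw [aCoeff, Real.sq_sqrt (tsum_nonneg fun _ => by positivity)]
  have e : ∑ j ∈ S, ‖muHat μ j‖^2 =
      ∑ j ∈ S.subtype (fun j => (∑ m, (j m) ^ 2) = (n : ℤ)), ‖muHat μ (j : Fin d → ℤ)‖^2 := by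
    rw [Finset.sum_subtype_of_mem (f := fun j => ‖muHat μ j‖^2) hS]
  rw [e]
  exact (Summable.of_finite).sum_le_tsum _ fun _ _ => by positivity

lemma lp_bound {d : ℕ} (μ : ComplexMeasure (Torus d)) (p : ℝ) (hp : 2 < p)
    (h : Summable (fun n : ℕ => aCoeff μ n ^ p)) :
    Summable (fun j => ‖muHat μ j‖^p) ∧ ∑' j, ‖muHat μ j‖^p ≤ ∑' n : ℕ, aCoeff μ n ^ p := by
  classical
  have ha : ∀ n, 0 ≤ aCoeff μ n := fun n => Real.sqrt_nonneg _
  have fin : ∀ S : Finset (Fin d → ℤ), ∑ j ∈ S, ‖muHat μ j‖^p ≤ ∑' n : ℕ, aCoeff μ n ^ p := by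
    intro S
    let N : (Fin d → ℤ) → ℕ := fun j => (∑ m, (j m) ^ 2).toNat
    have hN : ∀ j, (∑ m, (j m)^2) = (N j : ℤ) := fun j =>
      (Int.toNat_of_nonneg (Finset.sum_nonneg fun _ _ => sq_nonneg _)).symm
    rw [← Finset.sum_fiberwise_of_maps_to (t := S.image N) (g := N)
      (fun j hj => Finset.mem_image_of_mem _ hj)]
    refine le_trans (Finset.sum_le_sum fun n _ => ?_) (h.sum_le_tsum _ fun n _ => by
      have := ha n; positivity)
    have hmem : ∀ j ∈ S.filter (fun j => N j = n), (∑ m, (j m) ^ 2) = (n : ℤ) := by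
      intro j hj
      rw [hN j, (Finset.mem_filter.1 hj).2]
    have split : ∀ x : ℝ, 0 ≤ x → x^p = x^(p-2) * x^2 := by
      intro x hx
      rw [← Real.rpow_natCast x 2, ← Real.rpow_add' hx (by push_cast; linarith)]
      congr 1; push_cast; ring
    calc ∑ j ∈ S.filter (fun j => N j = n), ‖muHat μ j‖^p
        ≤ ∑ j ∈ S.filter (fun j => N j = n), aCoeff μ n ^ (p-2) * ‖muHat μ j‖^2 := by
          refine Finset.sum_le_sum fun j hj => ?_
          rw [split _ (norm_nonneg _)]
          gcongr
          have := fib_sum_le μ n {j} (by simpa using hmem j hj)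
          rw [Finset.sum_singleton] at this
          exact (sq_le_sq₀ (norm_nonneg _) (ha n)).1 this
      _ = aCoeff μ n ^ (p-2) * ∑ j ∈ S.filter (fun j => N j = n), ‖muHat μ j‖^2 := by
          rw [Finset.mul_sum]
      _ ≤ aCoeff μ n ^ (p-2) * aCoeff μ n ^ 2 := by
          have := Real.rpow_nonneg (ha n) (p-2)
          gcongr
          exact fib_sum_le μ n _ hmem
      _ = aCoeff μ n ^ p := (split _ (ha n)).symm
  have hs : Summable (fun j => ‖muHat μ j‖^p) :=
    summable_of_sum_le (fun j => by positivity) fin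
  exact ⟨hs, hs.tsum_le_of_sum_le fin⟩

lemma exists_bump (d : ℕ) : ∃ H : ℝ → ℂ, Continuous H ∧ (∀ t, 1/4 ≤ t → H t = 0) ∧
    ∃ Φ : SchwartzMap (EuclideanSpace ℝ (Fin d)) ℂ, (∀ x, Φ x = H (‖x‖^2)) ∧ ∫ x, Φ x = 1 := by
  let f : EuclideanSpace ℝ (Fin d) → ℝ := fun x => expNegInvGlue (1/4 - ‖x‖^2)
  have hf : ContDiff ℝ (⊤ : ℕ∞) f := expNegInvGlue.contDiff.comp (contDiff_const.sub (contDiff_norm_sq ℝ))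
  have hz : ∀ x, x ∉ Metric.closedBall (0 : EuclideanSpace ℝ (Fin d)) 1 → f x = 0 := by
    intro x hx
    apply expNegInvGlue.zero_of_nonpos
    simp only [Metric.mem_closedBall, dist_zero_right, not_le] at hx
    nlinarith
  have hc : HasCompactSupport f := HasCompactSupport.intro (isCompact_closedBall 0 1) hz
  have hpos : 0 < ∫ x, f x := by
    apply hf.continuous.integral_pos_of_hasCompactSupport_nonneg_nonzero hc
      (fun x => expNegInvGlue.nonneg _) (x := 0)
    exact (expNegInvGlue.pos_of_pos (by simp)).ne'
  set c := ∫ x, f x with hcdef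
  let G : EuclideanSpace ℝ (Fin d) → ℂ := fun x => ((c⁻¹ * f x : ℝ) : ℂ)
  have hG : ContDiff ℝ (⊤ : ℕ∞) G := Complex.ofRealCLM.contDiff.comp (contDiff_const.mul hf)
  have hGc : HasCompactSupport G := HasCompactSupport.intro (isCompact_closedBall 0 1) fun x hx => by
    simp [G, hz x hx]
  refine ⟨fun t => ((c⁻¹ * expNegInvGlue (1/4 - t) : ℝ) : ℂ), ?_, ?_, hGc.toSchwartzMap hG, ?_, ?_⟩
  · have : Continuous expNegInvGlue := (expNegInvGlue.contDiff (n := 0)).continuous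
    fun_prop
  · intro t ht
    dsimp only
    rw [expNegInvGlue.zero_of_nonpos (show 1/4 - t ≤ 0 by linarith)]; simp
  · intro x; rfl
  · change ∫ x, G x = 1
    simp only [G]
    rw [integral_complex_ofReal, integral_const_mul, ← hcdef, inv_mul_cancel₀ hpos.ne']
    simp

lemma exists_psi {d : ℕ} (hd : 1 ≤ d) (H : ℝ → ℂ) (hH : ∀ t, 1/4 ≤ t → H t = 0)
    (Φ : SchwartzMap (EuclideanSpace ℝ (Fin d)) ℂ) (hΦ : ∀ x, Φ x = H (‖x‖^2))
    (hΦ1 : ∫ x, Φ x = 1) :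
    ∃ ψ : SchwartzMap ℝ ℂ, (∀ t : ℝ, ψ (-t) = ψ t) ∧
      Function.support (𝓕 ⇑ψ) ⊆ Set.Icc (-1) 1 ∧ ψ 0 = 1 ∧ ∀ ξ, 𝓕 (⇑Φ) ξ = ψ ‖ξ‖ := by
  let e0 : (EuclideanSpace ℝ (Fin d)) := EuclideanSpace.single ⟨0, hd⟩ 1
  have he0 : ‖e0‖ = 1 := by simp [e0]
  let g : ℝ →L[ℝ] (EuclideanSpace ℝ (Fin d)) := ContinuousLinearMap.toSpanSingleton ℝ e0
  have hg : ∀ t, g t = t • e0 := fun t => by simp [g]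
  have hanti : AntilipschitzWith 1 g := by
    apply AddMonoidHomClass.antilipschitz_of_bound
    intro t
    simp [hg, norm_smul, he0]
  let ψ : SchwartzMap ℝ ℂ := SchwartzMap.compCLMOfAntilipschitz ℂ g.hasTemperateGrowth hanti (𝓕 Φ)
  have hψ : ∀ t, ψ t = 𝓕 (⇑Φ) (t • e0) := fun t => by
    rw [← hg]; rfl
  have hrad : ∀ v w : (EuclideanSpace ℝ (Fin d)), ‖v‖ = ‖w‖ → 𝓕 (⇑Φ) v = 𝓕 (⇑Φ) w := by
    intro v w hvw
    have h1 := Submodule.reflection_sub hvw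
    have h2 := Real.fourier_comp_linearIsometry (Submodule.reflection (Submodule.span ℝ {v - w})ᗮ) (⇑Φ) v
    rw [h1] at h2
    rw [← h2]
    have h3 : (⇑Φ ∘ ⇑(Submodule.reflection (Submodule.span ℝ {v - w})ᗮ)) = ⇑Φ := by
      funext x
      simp [hΦ]
    rw [h3]
  refine ⟨ψ, ?_, ?_, ?_, ?_⟩
  · intro t
    rw [hψ, hψ]
    apply hrad
    simp [norm_smul]
  · -- support
    have hcont : Continuous (𝓕 (⇑ψ)) := (𝓕 ψ).continuous
    have hU : IsOpen (Set.Icc (-1:ℝ) 1)ᶜ := isClosed_Icc.isOpen_compl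
    have hae : ∀ᵐ s : ℝ, s ∈ (Set.Icc (-1:ℝ) 1)ᶜ → 𝓕 (⇑ψ) s = 0 := by
      apply hU.ae_eq_zero_of_integral_contDiff_smul_eq_zero
        (hcont.locallyIntegrable.locallyIntegrableOn _)
      intro η0 hη0 hη0c hη0s
      let η1 : ℝ → ℂ := fun s => (η0 s : ℂ)
      have hη1 : ContDiff ℝ (⊤ : ℕ∞) η1 := Complex.ofRealCLM.contDiff.comp hη0
      have hη1c : HasCompactSupport η1 := hη0c.comp_left (g := fun x : ℝ => (x:ℂ)) rfl
      let η : SchwartzMap ℝ ℂ := hη1c.toSchwartzMap hη1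
      have hη : ∀ s, η s = η0 s := fun s => rfl
      have s1 : ∫ s, η0 s • 𝓕 (⇑ψ) s = ∫ s, 𝓕 (⇑ψ) s • η s := by
        congr 1; funext s; rw [hη]; simp [mul_comm]
      have s2 : ∫ s, 𝓕 (⇑ψ) s • η s = ∫ t, ψ t • 𝓕 (⇑η) t := by
        have := VectorFourier.integral_fourierIntegral_smul_eq_flip (μ := volume) (ν := volume)
          (L := innerₗ ℝ) (f := ⇑ψ) (g := ⇑η) Real.continuous_fourierChar
          (by exact continuous_inner) ψ.integrable η.integrable
        rw [flip_innerₗ] at this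
        exact this
      let L : (EuclideanSpace ℝ (Fin d)) →ₗ[ℝ] ℝ →ₗ[ℝ] ℝ := (innerₗ (EuclideanSpace ℝ (Fin d))).compl₂ (LinearMap.toSpanSingleton ℝ (EuclideanSpace ℝ (Fin d)) e0)
      have hL : ∀ x t, L x t = inner ℝ x (t • e0) := fun x t => by simp [L, inner_smul_right]
      have s3 : ∫ t, ψ t • 𝓕 (⇑η) t = ∫ x, Φ x • η (- inner ℝ x e0) := by
        have := VectorFourier.integral_fourierIntegral_smul_eq_flip (μ := volume) (ν := volume)
          (L := L) (f := ⇑Φ) (g := 𝓕 ⇑η) Real.continuous_fourierChar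
          (by simp_rw [hL]; fun_prop) Φ.integrable (𝓕 η).integrable
        have hA : ∀ t, VectorFourier.fourierIntegral Real.fourierChar volume L (⇑Φ) t = ψ t := by
          intro t
          rw [hψ, Real.fourier_eq]
          simp only [VectorFourier.fourierIntegral, hL]
        have hB : ∀ x, VectorFourier.fourierIntegral Real.fourierChar volume L.flip (𝓕 ⇑η) x
              = η (- inner ℝ x e0) := by
          intro x
          have h1 : VectorFourier.fourierIntegral Real.fourierChar volume L.flip (𝓕 ⇑η) x
              = 𝓕 (𝓕 ⇑η) (inner ℝ x e0) := by
            rw [Real.fourier_eq]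
            simp only [VectorFourier.fourierIntegral, LinearMap.flip_apply, hL]
            congr 1
            funext t
            congr 3
            simp [inner_smul_right, mul_comm]
          rw [h1]
          have h2 := congrArg (fun f : SchwartzMap ℝ ℂ => f (- inner ℝ x e0))
            (FourierTransform.fourierInv_fourier_eq (F := SchwartzMap ℝ ℂ) η)
          rw [← h2, SchwartzMap.fourierInv_coe, Real.fourierInv_eq_fourier_neg, neg_neg]
          rfl
        simp_rw [hA, hB] at this
        exact this
      rw [s1, s2, s3]
      apply integral_eq_zero_of_ae
      refine Filter.Eventually.of_forall fun x => ?_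
      by_cases hx : 1/4 ≤ ‖x‖^2
      · simp [hΦ, hH _ hx]
      · have hxn : ‖x‖ ≤ 1 := by
          by_contra h
          push Not at h hx
          nlinarith
        have h3 : |inner ℝ x e0| ≤ 1 := by
          have := abs_real_inner_le_norm x e0
          rw [he0, mul_one] at this
          exact this.trans hxn
        have h4 : η0 (-inner ℝ x e0) = 0 := by
          by_contra hne
          have := hη0s (subset_tsupport _ hne)
          apply this
          rw [abs_le] at h3
          constructor <;> linarith [h3.1, h3.2]
        simp [hη, h4]
    intro s hs
    by_contra hsU
    have hev : ∀ᶠ u in nhds s, u ∈ (Set.Icc (-1:ℝ) 1)ᶜ ∧ 𝓕 (⇑ψ) u ≠ 0 :=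
      Filter.Eventually.and (hU.mem_nhds hsU)
        (hcont.continuousAt.eventually_ne hs)
    obtain ⟨W, hW, hWo, hsW⟩ := _root_.eventually_nhds_iff.1 hev
    have hpos := hWo.measure_pos volume ⟨s, hsW⟩
    have : volume W = 0 := measure_mono_null (fun u hu => by
      have := hW u hu
      simp only [Set.mem_compl_iff, Set.mem_ofPred_eq, Classical.not_imp]
      exact this) hae
    exact hpos.ne' this
  · rw [hψ, zero_smul, Real.fourier_eq]
    simpa using hΦ1
  · intro ξ
    rw [hψ]
    apply hrad
    simp [norm_smul, he0]

/-- The periodized kernel. -/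
def kern {d : ℕ} (H : ℝ → ℂ) (R : ℝ) (x : Torus d) : ℂ := (R:ℂ)^d * H (R^2 * ∑ m, ‖x m‖^2)

lemma kern_cont {d : ℕ} (H : ℝ → ℂ) (hH : Continuous H) (R : ℝ) :
    Continuous (kern (d := d) H R) := by
  unfold kern
  fun_prop

lemma kern_coef {d : ℕ} (H : ℝ → ℂ) (hH : ∀ t, 1/4 ≤ t → H t = 0)
    (Φ : SchwartzMap (EuclideanSpace ℝ (Fin d)) ℂ) (hΦ : ∀ x, Φ x = H (‖x‖^2))
    (R : ℝ) (hR : 1 ≤ R) (j : Fin d → ℤ) :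
    𝓕 (⇑Φ) (WithLp.toLp 2 (fun m => (j m : ℝ) / R)) =
    ∫ x in {x : Fin d → ℝ | ∀ i, x i ∈ Set.Ioc (-(1/2):ℝ) (-(1/2) + 1)},
      torusChar (-j) (fun i => (x i : AddCircle (1:ℝ))) * kern H R (fun i => x i) := by
  have hR0 : 0 < R := by linarith
  -- the Euclidean integrand
  let G : (Fin d → ℝ) → ℂ := fun x =>
    (Real.fourierChar (-(∑ m, x m * j m)) : ℂ) * ((R:ℂ)^d * H (R^2 * ∑ m, (x m)^2))
  have hbox : MeasurableSet {x : Fin d → ℝ | ∀ i, x i ∈ Set.Ioc (-(1/2):ℝ) (-(1/2) + 1)} := 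
    MeasurableSet.univ_pi' (fun i => measurableSet_Ioc)
  have h1 : ∫ x in {x : Fin d → ℝ | ∀ i, x i ∈ Set.Ioc (-(1/2):ℝ) (-(1/2) + 1)},
      torusChar (-j) (fun i => (x i : AddCircle (1:ℝ))) * kern H R (fun i => x i) =
      ∫ x in {x : Fin d → ℝ | ∀ i, x i ∈ Set.Ioc (-(1/2):ℝ) (-(1/2) + 1)}, G x := by
    refine setIntegral_congr_fun hbox fun x hx => ?_
    have hx' : ∀ i, x i ∈ Set.Ioc (-(1/2):ℝ) (-(1/2) + 1) := hx
    have hn : ∀ m, ‖((x m : ℝ) : AddCircle (1:ℝ))‖ = |x m| := by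
      intro m
      rw [AddCircle.norm_coe_eq_abs_iff (1:ℝ) one_ne_zero, abs_one, abs_le]
      have := hx' m
      constructor <;> linarith [this.1, this.2]
    simp only [kern, hn, sq_abs, G]
    congr 1
    simp only [torusChar, fourier_coe_apply, Real.fourierChar_apply, ← Complex.exp_sum]
    congr 1
    push_cast
    rw [mul_neg, Finset.mul_sum, neg_mul, Finset.sum_mul, ← Finset.sum_neg_distrib]
    refine Finset.sum_congr rfl fun m _ => ?_
    simp
    ring
  have h2 : ∫ x in {x : Fin d → ℝ | ∀ i, x i ∈ Set.Ioc (-(1/2):ℝ) (-(1/2) + 1)}, G x = ∫ x, G x := by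
    apply setIntegral_eq_integral_of_forall_compl_eq_zero
    intro x hx
    have : ∃ m, x m ∉ Set.Ioc (-(1/2):ℝ) (-(1/2) + 1) := by
      by_contra h
      push Not at h
      exact hx h
    obtain ⟨m, hm⟩ := this
    have hm2 : 1/4 ≤ (x m)^2 := by
      by_contra h
      apply hm
      have : |x m| < 1/2 := by
        apply abs_lt_of_sq_lt_sq _ (by norm_num)
        linarith
      rw [abs_lt] at this
      constructor <;> linarith [this.1, this.2]
    have hs : (x m)^2 ≤ ∑ m, (x m)^2 :=
      Finset.single_le_sum (f := fun m => (x m)^2) (fun _ _ => sq_nonneg _) (Finset.mem_univ m)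
    have : 1/4 ≤ R^2 * ∑ m, (x m)^2 := by
      have : 1 ≤ R^2 := one_le_pow₀ hR
      nlinarith
    simp [G, hH _ this]
  rw [h1, h2, Real.fourier_eq]
  have h3 := Measure.integral_comp_smul (volume : Measure (EuclideanSpace ℝ (Fin d)))
    (fun v : EuclideanSpace ℝ (Fin d) =>
      Real.fourierChar (-inner ℝ v (WithLp.toLp 2 (fun m => (j m : ℝ) / R))) • Φ v) R
  have h4 : ∫ x, G x = (R^d : ℝ) • ∫ y : EuclideanSpace ℝ (Fin d),
      Real.fourierChar (-inner ℝ (R • y) (WithLp.toLp 2 (fun m => (j m : ℝ) / R))) • Φ (R • y) := by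
    rw [← integral_smul]
    have hG := (EuclideanSpace.volume_preserving_symm_measurableEquiv_toLp (Fin d)).integral_comp' G
    rw [← hG]
    congr 1
    funext y
    have e1 : inner ℝ (R • y) (WithLp.toLp 2 (fun m => (j m : ℝ) / R)) = ∑ m, y m * j m := by
      rw [PiLp.inner_apply]
      refine Finset.sum_congr rfl fun m _ => ?_
      simp
      field_simp
    have e2 : ‖R • y‖^2 = R^2 * ∑ m, (y m)^2 := by
      rw [norm_smul, mul_pow, EuclideanSpace.norm_sq_eq]
      simp
    rw [e1, hΦ, e2]
    simp only [G, Circle.smul_def, Complex.real_smul, smul_eq_mul]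
    push_cast
    change ((Real.fourierChar (-∑ m, y m * (j m:ℝ)) : Circle) : ℂ) * ((R:ℂ)^d * H (R^2 * ∑ m, (y m)^2)) = _
    ring
  rw [h4, h3]
  simp only [finrank_euclideanSpace_fin]
  rw [abs_of_pos (by positivity), smul_smul, mul_inv_cancel₀ (by positivity), one_smul]

lemma toLp_norm {d : ℕ} (R : ℝ) (hR : 1 ≤ R) (j : Fin d → ℤ) :
    ‖(WithLp.toLp 2 (fun m => (j m : ℝ) / R) : EuclideanSpace ℝ (Fin d))‖ = jnorm j / R := by
  have hR0 : 0 < R := by linarith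
  rw [EuclideanSpace.norm_eq, jnorm]
  have : ∑ m, ‖(j m : ℝ) / R‖^2 = (∑ m, (j m : ℝ)^2) / R^2 := by
    rw [Finset.sum_div]
    refine Finset.sum_congr rfl fun m _ => ?_
    rw [Real.norm_eq_abs, sq_abs, div_pow]
  simp only [this]
  rw [Real.sqrt_div' _ (by positivity), Real.sqrt_sq hR0.le]

lemma kern_supp {d : ℕ} (H : ℝ → ℂ) (hH : ∀ t, 1/4 ≤ t → H t = 0) (R : ℝ) (hR : 1 ≤ R)
    (x y : Torus d) (h : 1 / R ≤ dist x y) : kern H R (x - y) = 0 := by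
  have hR0 : 0 < R := by linarith
  have : ∃ m, 1 / R ≤ dist (x m) (y m) := by
    by_contra hc
    push Not at hc
    have := (dist_pi_lt_iff (by positivity : 0 < 1 / R)).2 hc
    linarith
  obtain ⟨m, hm⟩ := this
  rw [dist_eq_norm] at hm
  have hs : ‖(x - y) m‖^2 ≤ ∑ m, ‖(x - y) m‖^2 :=
    Finset.single_le_sum (f := fun m => ‖(x - y) m‖^2) (fun _ _ => sq_nonneg _) (Finset.mem_univ m)
  have h1 : 1 ≤ R * ‖(x - y) m‖ := by
    rw [div_le_iff₀ hR0] at hm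
    rw [Pi.sub_apply]; linarith
  have h2 : 1 / 4 ≤ R^2 * ∑ m, ‖(x - y) m‖^2 := by
    have h3 : 1 ≤ (R * ‖(x - y) m‖)^2 := one_le_pow₀ h1
    have h4 : R^2 * ‖(x - y) m‖^2 ≤ R^2 * ∑ m, ‖(x - y) m‖^2 := by gcongr
    nlinarith
  rw [kern, hH _ h2, mul_zero]

lemma cs_bound {d : ℕ} (P : Torus d → ℂ) (hP : Continuous P) (T : Set (Torus d)) (hT : IsOpen T)
    (hPT : ∀ x, x ∉ T → P x = 0) (χ : C(Torus d, ℂ)) :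
    ‖∫ x, P x * (starRingEnd ℂ) (χ x)‖ ≤
      Real.sqrt (volume.real T) * Real.sqrt (∫ x, ‖P x‖^2) * ‖χ‖ := by
  have hint : Integrable (fun x => ‖P x‖) (volume : Measure (Torus d)) :=
    (hP.norm.integrable_of_hasCompactSupport (HasCompactSupport.of_compactSpace _))
  have h1 : ‖∫ x, P x * (starRingEnd ℂ) (χ x)‖ ≤ ∫ x, ‖P x‖ * ‖χ‖ := by
    refine norm_integral_le_of_norm_le (hint.mul_const _) (Eventually.of_forall fun x => ?_)
    rw [norm_mul, RCLike.norm_conj]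
    gcongr
    exact χ.norm_coe_le_norm x
  rw [integral_mul_const] at h1
  have h2 : ∫ x, ‖P x‖ ≤ Real.sqrt (volume.real T) * Real.sqrt (∫ x, ‖P x‖^2) := by
    have h3 : ∫ x, ‖P x‖ = ∫ x, T.indicator (fun _ => (1:ℝ)) x * ‖P x‖ := by
      congr 1
      funext x
      by_cases hx : x ∈ T
      · simp [hx]
      · simp [hx, hPT x hx]
    rw [h3]
    have hm1 : MemLp (T.indicator (fun _ => (1:ℝ))) (ENNReal.ofReal 2) (volume : Measure (Torus d)) :=
      memLp_indicator_const _ hT.measurableSet _ (Or.inr (measure_ne_top _ _))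
    have hm2 : MemLp (fun x => ‖P x‖) (ENNReal.ofReal 2) (volume : Measure (Torus d)) :=
      hP.norm.memLp_of_hasCompactSupport (HasCompactSupport.of_compactSpace _)
    have := integral_mul_le_Lp_mul_Lq_of_nonneg (μ := (volume : Measure (Torus d)))
      Real.HolderConjugate.two_two
      (f := T.indicator (fun _ => (1:ℝ))) (g := fun x => ‖P x‖)
      (Eventually.of_forall fun x => Set.indicator_nonneg (fun _ _ => zero_le_one) x)
      (Eventually.of_forall fun x => norm_nonneg _) hm1 hm2
    refine this.trans (le_of_eq ?_)
    rw [Real.sqrt_eq_rpow, Real.sqrt_eq_rpow]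
    simp only [Real.rpow_two]
    congr 2
    rw [← integral_indicator_one hT.measurableSet]
    congr 1
    funext x
    by_cases hx : x ∈ T <;> simp [hx]
  exact h1.trans (mul_le_mul_of_nonneg_right h2 (norm_nonneg _))

lemma holder_sum {ι : Type*} (p : ℝ) (hp : 2 < p) (a b : ι → ℂ)
    (ha : Summable fun j => ‖a j‖ ^ (2 * (p / (p - 2))))
    (hb : Summable fun j => ‖b j‖ ^ p) :
    Summable (fun j => ‖a j * b j‖^2) ∧
    ∑' j, ‖a j * b j‖^2 ≤ (∑' j, ‖a j‖ ^ (2 * (p / (p - 2)))) ^ ((p - 2) / p) *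
      (∑' j, ‖b j‖ ^ p) ^ (2 / p) := by
  have hc : Real.HolderConjugate (p / (p - 2)) (p / 2) := by
    rw [Real.holderConjugate_iff]
    have : 0 < p - 2 := by linarith
    constructor
    · rw [lt_div_iff₀ this]; linarith
    · field_simp; ring
  have e1 : ∀ j, (‖a j‖^2) ^ (p / (p - 2)) = ‖a j‖ ^ (2 * (p / (p - 2))) := fun j => by
    rw [Real.rpow_mul (norm_nonneg _), Real.rpow_two]
  have e2 : ∀ j, (‖b j‖^2) ^ (p / 2) = ‖b j‖ ^ p := fun j => by
    rw [← Real.rpow_two, ← Real.rpow_mul (norm_nonneg _)]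
    congr 1; ring
  have h := Real.inner_le_Lp_mul_Lq_tsum_of_nonneg hc (f := fun j => ‖a j‖^2)
    (g := fun j => ‖b j‖^2) (fun j => by positivity) (fun j => by positivity)
    (by simpa only [e1] using ha) (by simpa only [e2] using hb)
  simp only [e1, e2, one_div_div] at h
  simp only [norm_mul, mul_pow]
  refine ⟨?_, h⟩
  exact Real.summable_mul_of_Lp_Lq_of_nonneg hc (f := fun j => ‖a j‖^2)
    (g := fun j => ‖b j‖^2) (fun j => by positivity) (fun j => by positivity)
    (by simpa only [e1] using ha) (by simpa only [e2] using hb)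

lemma vol_bound {d : ℕ} (k : ℝ) (hkd : k < d) (C_E δ₀ : ℝ) (hδ₀ : 0 < δ₀) (hCE : 0 < C_E)
    (E : Set (Torus d))
    (hE : ∀ δ : ℝ, 0 < δ → δ ≤ δ₀ →
            volume (Metric.thickening δ E) ≤ ENNReal.ofReal (C_E * δ ^ ((d : ℝ) - k)))
    (R : ℝ) (hR : 1 ≤ R) :
    volume.real (Metric.thickening (1 / R) E) ≤
      max C_E (δ₀ ^ (k - d)) * R ^ (k - d) := by
  have hR0 : 0 < R := by linarith
  have hRp : 0 < R ^ (k - d) := Real.rpow_pos_of_pos hR0 _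
  have he : (1 / R) ^ ((d:ℝ) - k) = R ^ (k - d) := by
    rw [one_div, Real.inv_rpow hR0.le, ← Real.rpow_neg hR0.le]
    congr 1; ring
  by_cases h : 1 / R ≤ δ₀
  · have h1 := hE (1 / R) (by positivity) h
    rw [he] at h1
    have h2 : volume.real (Metric.thickening (1 / R) E) ≤ C_E * R ^ (k - d) :=
      ENNReal.toReal_le_of_le_ofReal (by positivity) h1
    exact h2.trans (mul_le_mul_of_nonneg_right (le_max_left _ _) hRp.le)
  · push Not at h
    have h1 : volume.real (Metric.thickening (1 / R) E) ≤ 1 := measureReal_le_one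
    refine h1.trans ?_
    have h2 : (1:ℝ) ≤ δ₀ ^ (k - d) * R ^ (k - d) := by
      rw [← Real.mul_rpow hδ₀.le hR0.le]
      apply Real.one_le_rpow_of_pos_of_le_one_of_nonpos (by positivity) _ (by linarith)
      rw [lt_div_iff₀ hR0] at h
      exact h.le
    exact h2.trans (mul_le_mul_of_nonneg_right (le_max_right _ _) hRp.le)
/-- **Quantitative stability for thinly supported measures on the torus**
(Theorem 1.3, case `M = 𝕋^d`): there is an even Schwartz function `ψ` with `ψ̂`
supported in `[-1,1]` and `ψ(0)=1`, and a constant `C`, such that for every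
thinly supported measure `μ` with finite spectral `ℓ^p` mass, every scale `R ≥ 1`
and every continuous test function `χ`, the low-pass reconstruction
`P_Rμ = Σ_j ψ(|j|/R) μ̂(j) e_j` is an (absolutely convergent) continuous function with
`|⟨P_Rμ, χ⟩| ≤ C ‖μ‖_{ℓ̂^p} ‖χ‖_∞ R^{k/2 - d/p}`. -/
theorem quantitative_stability_torus
    (d : ℕ) (hd : 1 ≤ d) (k : ℝ) (hk0 : 0 < k) (hkd : k < d)
    (p : ℝ) (hp2 : 2 < p) (hp : p < 2 * d / k)
    (C_E δ₀ : ℝ) (hCE : 0 < C_E) (hδ₀ : 0 < δ₀) (hδ₀1 : δ₀ ≤ 1) :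
    ∃ ψ : SchwartzMap ℝ ℂ, (∀ t : ℝ, ψ (-t) = ψ t) ∧
      Function.support (𝓕 ⇑ψ) ⊆ Set.Icc (-1) 1 ∧ ψ 0 = 1 ∧
      ∃ C : ℝ, 0 < C ∧
        ∀ (E : Set (Torus d)), IsCompact E →
          (∀ δ : ℝ, 0 < δ → δ ≤ δ₀ →
            volume (Metric.thickening δ E) ≤ ENNReal.ofReal (C_E * δ ^ ((d : ℝ) - k))) →
          ∀ (μ : ComplexMeasure (Torus d)), msupport μ ⊆ E →
            Summable (fun n : ℕ => aCoeff μ n ^ p) →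
            ∀ R : ℝ, 1 ≤ R → ∀ χ : C(Torus d, ℂ),
              Summable (fun j : Fin d → ℤ => ‖(ψ (jnorm j / R)) * muHat μ j‖) ∧
              Continuous (fun x : Torus d =>
                ∑' j : Fin d → ℤ, (ψ (jnorm j / R)) * muHat μ j * torusChar j x) ∧
              ‖∫ x : Torus d,
                  (∑' j : Fin d → ℤ, (ψ (jnorm j / R)) * muHat μ j * torusChar j x)
                    * (starRingEnd ℂ) (χ x) ∂volume‖
                ≤ C * (∑' n : ℕ, aCoeff μ n ^ p) ^ (1 / p) * ‖χ‖
                    * R ^ (k / 2 - (d : ℝ) / p) := by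
  obtain ⟨H, hHc, hH0, Φ, hΦ, hΦ1⟩ := exists_bump d
  obtain ⟨ψ, hev, hsupp, hψ0, hψ⟩ := exists_psi hd H hH0 Φ hΦ hΦ1
  refine ⟨ψ, hev, hsupp, hψ0, ?_⟩
  have hp0 : 0 < p := by linarith
  have hp20 : 0 < p - 2 := by linarith
  have hs : 1 ≤ 2 * (p / (p - 2)) := by
    have : 1 ≤ p / (p - 2) := by rw [le_div_iff₀ hp20]; linarith
    linarith
  obtain ⟨K, hK, hKR⟩ := psi_bound (d := d) ψ (2 * (p / (p - 2))) hs
  set C' := max C_E (δ₀ ^ (k - d)) with hC'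
  have hC'0 : 0 < C' := lt_of_lt_of_le hCE (le_max_left _ _)
  refine ⟨Real.sqrt (C' * K ^ ((p - 2) / p)), by positivity, ?_⟩
  intro E hE hvol μ hμ hsum R hR χ
  have hR0 : 0 < R := by linarith
  obtain ⟨hψs, hψq, hψb⟩ := hKR R hR
  obtain ⟨hμs, hμb⟩ := lp_bound μ p hp2 hsum
  obtain ⟨B, hB0, hB⟩ := muHat_bdd μ
  have hsn : Summable (fun j : Fin d → ℤ => ‖(ψ (jnorm j / R)) * muHat μ j‖) := by
    refine Summable.of_nonneg_of_le (fun j => norm_nonneg _) (fun j => ?_) (hψs.norm.mul_right B)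
    rw [norm_mul]
    exact mul_le_mul_of_nonneg_left (hB j) (norm_nonneg _)
  obtain ⟨hs2, hhold⟩ := holder_sum p hp2 (fun j : Fin d → ℤ => ψ (jnorm j / R)) (muHat μ) hψq hμs
  obtain ⟨hcont, hpars⟩ := parseval (fun j : Fin d → ℤ => ψ (jnorm j / R) * muHat μ j) hsn.of_norm hs2
  refine ⟨hsn, hcont, ?_⟩
  have hF : ∀ x, HasSum (fun j => ψ (jnorm j / R) * torusChar j x)
      ((⟨kern H R, kern_cont H hHc R⟩ : C(Torus d, ℂ)) x) := by
    refine fourier_inv _ _ hψs fun j => ?_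
    rw [← toLp_norm R hR j, ← hψ]
    exact kern_coef H hH0 Φ hΦ R hR j
  have hvan : ∀ x, x ∉ Metric.thickening (1 / R) E →
      ∑' j : Fin d → ℤ, (ψ (jnorm j / R)) * muHat μ j * torusChar j x = 0 := by
    intro x hx
    rw [conv_series μ _ _ hψs hF x]
    refine cIntegral_zero μ E hμ _ fun y hy => ?_
    refine kern_supp H hH0 R hR x y ?_
    by_contra hlt
    push Not at hlt
    exact hx (Metric.mem_thickening_iff.2 ⟨y, hy, hlt⟩)
  refine (cs_bound _ hcont _ Metric.isOpen_thickening hvan χ).trans ?_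
  rw [hpars]
  have hV := vol_bound k hkd C_E δ₀ hδ₀ hCE E hvol R hR
  rw [← hC'] at hV
  set S := ∑' n : ℕ, aCoeff μ n ^ p with hS
  have hS0 : 0 ≤ S := tsum_nonneg fun n => Real.rpow_nonneg (Real.sqrt_nonneg _) _
  have hW : ∑' j : Fin d → ℤ, ‖ψ (jnorm j / R) * muHat μ j‖^2 ≤
      (K * R^d) ^ ((p - 2) / p) * S ^ (2 / p) := by
    refine hhold.trans ?_
    have n1 : 0 ≤ ∑' j : Fin d → ℤ, ‖ψ (jnorm j / R)‖ ^ (2 * (p / (p - 2))) :=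
      tsum_nonneg fun n => Real.rpow_nonneg (norm_nonneg _) _
    have n2 : 0 ≤ ∑' j : Fin d → ℤ, ‖muHat μ j‖ ^ p :=
      tsum_nonneg fun n => Real.rpow_nonneg (norm_nonneg _) _
    gcongr
  have hfin : Real.sqrt (volume.real (Metric.thickening (1 / R) E)) *
      Real.sqrt (∑' j : Fin d → ℤ, ‖ψ (jnorm j / R) * muHat μ j‖^2) ≤
      Real.sqrt (C' * K ^ ((p - 2) / p)) * S ^ (1 / p) * R ^ (k / 2 - (d : ℝ) / p) := by
    rw [← Real.sqrt_mul measureReal_nonneg]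
    have e : (C' * R ^ (k - d)) * ((K * R^d) ^ ((p - 2) / p) * S ^ (2 / p)) =
        (Real.sqrt (C' * K ^ ((p - 2) / p)) * S ^ (1 / p) * R ^ (k / 2 - (d : ℝ) / p))^2 := by
      rw [mul_pow, mul_pow, Real.sq_sqrt (by positivity), ← Real.rpow_mul_natCast hS0,
        ← Real.rpow_mul_natCast hR0.le, Real.mul_rpow hK.le (by positivity), ← Real.rpow_natCast R d,
        ← Real.rpow_mul hR0.le]
      have e3 : R ^ ((k / 2 - (d : ℝ) / p) * ((2:ℕ):ℝ)) =
          R ^ (k - d) * R ^ ((d:ℝ) * ((p - 2) / p)) := by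
        rw [← Real.rpow_add hR0]
        congr 1
        push_cast
        field_simp
        ring
      have e4 : (1 / p) * ((2:ℕ):ℝ) = 2 / p := by push_cast; ring
      rw [e3, e4]
      ring
    rw [← Real.sqrt_sq (by positivity : 0 ≤ Real.sqrt (C' * K ^ ((p - 2) / p)) * S ^ (1 / p) * R ^ (k / 2 - (d : ℝ) / p)), ← e]
    apply Real.sqrt_le_sqrt
    have n3 : 0 ≤ ∑' j : Fin d → ℤ, ‖ψ (jnorm j / R) * muHat μ j‖^2 :=
      tsum_nonneg fun n => by positivity
    exact mul_le_mul hV hW n3 (by positivity)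
  calc _ ≤ _ := mul_le_mul_of_nonneg_right hfin (norm_nonneg χ)
    _ = _ := by ring
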